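/- Let s > 1 and t > 1. Then EXP-(s,t)-WT holds if and only if lim_{j→∞} (log λ_j⁻¹)^s / log j = ∞, i.e., for every M > 0 one has (log λ_j⁻¹)^s > M·log j for all sufficiently large j (understood to hold at j whenever λ_j = 0); no condition on the weights γ_j is needed. -/

import Mathlib

open Filter Real Set Topology
open scoped ENNReal NNReal

noncomputable section

/-- The weighted eigenvalues `λ_{k,j}`: `1` if `j = 1`, and `γ_k · λ_j` if `j ≥ 2`. -/
def lamKJ (γ lam : ℕ → ℝ) (k j : ℕ) : ℝ := if j = 1 then 1 else γ k * lam j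

/-- The information complexity `n(ε,d)`: the extended-natural cardinality of the set of
`d`-tuples of positive integers `(n_1,…,n_d)` with `λ_{1,n_1} ⋯ λ_{d,n_d} > ε²`. -/
def infoN (γ lam : ℕ → ℝ) (ε : ℝ) (d : ℕ) : ℕ∞ :=
  {n : Fin d → ℕ | (∀ i, 1 ≤ n i) ∧ ε ^ 2 < ∏ i, lamKJ γ lam (i.1 + 1) (n i)}.encard

/-- EXP-SPT with a given exponent `p`: there is `C ≥ 0` with
`n(ε,d) ≤ C (1 + log ε⁻¹)^p` for all `d ≥ 1` and `ε ∈ (0,1]`. -/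
def ExpSPTwith (γ lam : ℕ → ℝ) (p : ℝ) : Prop :=
  ∃ C : ℝ, 0 ≤ C ∧ ∀ d : ℕ, 1 ≤ d → ∀ ε : ℝ, 0 < ε → ε ≤ 1 →
    (infoN γ lam ε d : ℝ≥0∞) ≤ ENNReal.ofReal (C * (1 + Real.log ε⁻¹) ^ p)

/-- Exponential strong polynomial tractability. -/
def ExpSPT (γ lam : ℕ → ℝ) : Prop := ∃ p : ℝ, 0 ≤ p ∧ ExpSPTwith γ lam p

/-- Exponential polynomial tractability: there are `C, q, p ≥ 0` with
`n(ε,d) ≤ C d^q (1 + log ε⁻¹)^p` for all `d ≥ 1` and `ε ∈ (0,1]`. -/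
def ExpPT (γ lam : ℕ → ℝ) : Prop :=
  ∃ C q p : ℝ, 0 ≤ C ∧ 0 ≤ q ∧ 0 ≤ p ∧ ∀ d : ℕ, 1 ≤ d → ∀ ε : ℝ, 0 < ε → ε ≤ 1 →
    (infoN γ lam ε d : ℝ≥0∞) ≤ ENNReal.ofReal (C * (d : ℝ) ^ q * (1 + Real.log ε⁻¹) ^ p)

/-- EXP-QPT with a given exponent `t`. -/
def ExpQPTwith (γ lam : ℕ → ℝ) (t : ℝ) : Prop :=
  ∃ C : ℝ, 0 ≤ C ∧ ∀ d : ℕ, 1 ≤ d → ∀ ε : ℝ, 0 < ε → ε ≤ 1 →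
    (infoN γ lam ε d : ℝ≥0∞) ≤
      ENNReal.ofReal (C * Real.exp (t * (1 + Real.log d) * (1 + Real.log (1 + Real.log ε⁻¹))))

/-- Exponential quasi-polynomial tractability. -/
def ExpQPT (γ lam : ℕ → ℝ) : Prop := ∃ t : ℝ, 0 ≤ t ∧ ExpQPTwith γ lam t

/-- Exponential `(s,t)`-weak tractability:
`log max(1, n(ε,d)) / (d^t + (1 + log ε⁻¹)^s) → 0` as `d + ε⁻¹ → ∞`
(in particular `n(ε,d)` is finite for all such `d, ε`). -/
def ExpSTWT (γ lam : ℕ → ℝ) (s t : ℝ) : Prop :=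
  ∀ δ : ℝ, 0 < δ → ∃ T : ℝ, ∀ d : ℕ, 1 ≤ d → ∀ ε : ℝ, 0 < ε → ε ≤ 1 →
    T ≤ (d : ℝ) + ε⁻¹ →
    ∃ N : ℕ, infoN γ lam ε d = (N : ℕ∞) ∧
      Real.log (max 1 (N : ℝ)) / ((d : ℝ) ^ t + (1 + Real.log ε⁻¹) ^ s) < δ

/-- `j(ε) = max { j ≥ 1 : λ_j > ε² }` (a well-defined maximum when `λ_j → 0`). -/
def jEps (lam : ℕ → ℝ) (ε : ℝ) : ℕ := sSup {j : ℕ | 1 ≤ j ∧ ε ^ 2 < lam j}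

/-- `d(ε) = max { d ≥ 1 : γ_d > ε² }`, with `d(ε) = 0` if `γ_1 ≤ ε²`
(a well-defined maximum when `γ_d → 0`). -/
def dEps (γ : ℕ → ℝ) (ε : ℝ) : ℕ := sSup {d : ℕ | 1 ≤ d ∧ ε ^ 2 < γ d}

theorem exists_bound_sum_inv_sq :
    ∃ Z : ℝ, 1 ≤ Z ∧ ∀ K : ℕ, ∑ k ∈ Finset.Icc 1 K, ((k : ℝ) ^ 2)⁻¹ ≤ Z := by
  refine ⟨max 1 (∑' k : ℕ, ((k : ℝ) ^ 2)⁻¹), le_max_left _ _, fun K => le_max_of_le_right ?_⟩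
  have hsum : Summable fun k : ℕ => ((k : ℝ) ^ 2)⁻¹ :=
    Real.summable_nat_pow_inv.2 one_lt_two
  exact hsum.sum_le_tsum _ fun k _ => by positivity

/-- A set of `d`-tuples of positive integers whose entries have product at most `X` is finite and
has at most `X² Z^d` elements, where `Z` bounds `∑ k⁻²`. -/
theorem exists_encard_eq_of_prod_le {d : ℕ} {A : Set (Fin d → ℕ)} {X Z : ℝ}
    (hZ : ∀ K : ℕ, ∑ k ∈ Finset.Icc 1 K, ((k : ℝ) ^ 2)⁻¹ ≤ Z)
    (hA : ∀ n ∈ A, (∀ i, 1 ≤ n i) ∧ ∏ i, (n i : ℝ) ≤ X) :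
    ∃ N : ℕ, A.encard = N ∧ (N : ℝ) ≤ X ^ 2 * Z ^ d := by
  classical
  set P : Finset (Fin d → ℕ) := Fintype.piFinset fun _ => Finset.Icc 1 ⌊X⌋₊ with hP
  have hAP : ∀ n ∈ A, n ∈ P := by
    intro n hn
    obtain ⟨h1, h2⟩ := hA n hn
    rw [hP, Fintype.mem_piFinset]
    refine fun i => Finset.mem_Icc.2 ⟨h1 i, Nat.le_floor (le_trans ?_ h2)⟩
    exact_mod_cast Finset.single_le_prod' (f := n) (fun j _ => h1 j) (Finset.mem_univ i)
  have hfin : A.Finite := P.finite_toSet.subset hAP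
  refine ⟨hfin.toFinset.card, hfin.encard_eq_coe_toFinset_card, ?_⟩
  calc (hfin.toFinset.card : ℝ) = ∑ n ∈ hfin.toFinset, (1 : ℝ) := by simp
    _ ≤ ∑ n ∈ hfin.toFinset, X ^ 2 * ∏ i, ((n i : ℝ) ^ 2)⁻¹ := by
        refine Finset.sum_le_sum fun n hn => ?_
        obtain ⟨h1, h2⟩ := hA n (hfin.mem_toFinset.1 hn)
        have hpos : 0 < ∏ i, (n i : ℝ) :=
          Finset.prod_pos fun i _ => by exact_mod_cast h1 i
        rw [Finset.prod_inv_distrib, Finset.prod_pow, ← div_eq_mul_inv,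
          one_le_div (by positivity)]
        gcongr
    _ ≤ ∑ n ∈ P, X ^ 2 * ∏ i, ((n i : ℝ) ^ 2)⁻¹ :=
        Finset.sum_le_sum_of_subset_of_nonneg
          (fun n hn => hAP n (hfin.mem_toFinset.1 hn)) fun n _ _ => by positivity
    _ = X ^ 2 * ∏ _i : Fin d, ∑ k ∈ Finset.Icc 1 ⌊X⌋₊, ((k : ℝ) ^ 2)⁻¹ := by
        rw [← Finset.mul_sum, Finset.prod_univ_sum]
    _ ≤ X ^ 2 * Z ^ d := by
        rw [Finset.prod_const, Finset.card_univ, Fintype.card_fin]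
        have h0 : 0 ≤ ∑ k ∈ Finset.Icc 1 ⌊X⌋₊, ((k : ℝ) ^ 2)⁻¹ :=
          Finset.sum_nonneg fun k _ => by positivity
        gcongr
        exact hZ _

theorem sum_rpow_le_rpow_of_sum_le {ι : Type*} {I : Finset ι} {f : ι → ℝ} {L s : ℝ}
    (hs : 1 < s) (hf : ∀ i ∈ I, 0 ≤ f i) (hL : ∑ i ∈ I, f i ≤ L) :
    ∑ i ∈ I, f i ^ s ≤ L ^ s := by
  have hL0 : 0 ≤ L := (Finset.sum_nonneg hf).trans hL
  have hsplit : ∀ x : ℝ, 0 ≤ x → x ^ s = x ^ (s - 1) * x := fun x hx => by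
    rw [← Real.rpow_add_one' hx (by linarith), sub_add_cancel]
  calc ∑ i ∈ I, f i ^ s ≤ ∑ i ∈ I, L ^ (s - 1) * f i := by
        refine Finset.sum_le_sum fun i hi => ?_
        rw [hsplit _ (hf i hi)]
        have hiL : f i ≤ L := (Finset.single_le_sum hf hi).trans hL
        have := hf i hi
        gcongr
    _ = L ^ (s - 1) * ∑ i ∈ I, f i := by rw [Finset.mul_sum]
    _ ≤ L ^ (s - 1) * L := by gcongr
    _ = L ^ s := (hsplit L hL0).symm

theorem lamKJ_nonneg {γ lam : ℕ → ℝ} (hlam_nonneg : ∀ j, 1 ≤ j → 0 ≤ lam j)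
    (hγ_pos : ∀ j, 1 ≤ j → 0 < γ j) {k j : ℕ} (hk : 1 ≤ k) (hj : 1 ≤ j) :
    0 ≤ lamKJ γ lam k j := by
  unfold lamKJ
  split_ifs
  · exact zero_le_one
  · exact mul_nonneg (hγ_pos k hk).le (hlam_nonneg j hj)

theorem lamKJ_le {γ lam : ℕ → ℝ} (hlam1 : lam 1 = 1) (hlam_nonneg : ∀ j, 1 ≤ j → 0 ≤ lam j)
    (hγ_le : ∀ j, 1 ≤ j → γ j ≤ 1) {k j : ℕ} (hk : 1 ≤ k) (hj : 1 ≤ j) :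
    lamKJ γ lam k j ≤ lam j := by
  unfold lamKJ
  split_ifs with h
  · rw [h, hlam1]
  · exact mul_le_of_le_one_left (hlam_nonneg j hj) (hγ_le k hk)

theorem le_lamKJ {γ lam : ℕ → ℝ} (hlam1 : lam 1 = 1) (hγ_le : ∀ j, 1 ≤ j → γ j ≤ 1)
    {k : ℕ} (hk : 1 ≤ k) (j : ℕ) : γ k * lam j ≤ lamKJ γ lam k j := by
  unfold lamKJ
  split_ifs with h
  · rw [h, hlam1, mul_one]
    exact hγ_le k hk
  · exact le_rfl

theorem le_one_of_antitoneOn {lam : ℕ → ℝ} (hlam_anti : AntitoneOn lam (Set.Ici 1))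
    (hlam1 : lam 1 = 1) {j : ℕ} (hj : 1 ≤ j) : lam j ≤ 1 :=
  hlam1 ▸ hlam_anti (mem_Ici.2 le_rfl) (mem_Ici.2 hj) hj

theorem natCast_le_infoN_one {γ lam : ℕ → ℝ} (hlam_anti : AntitoneOn lam (Set.Ici 1))
    (hlam1 : lam 1 = 1) (hγ_pos : ∀ j, 1 ≤ j → 0 < γ j) (hγ_le : ∀ j, 1 ≤ j → γ j ≤ 1)
    {ε : ℝ} {j : ℕ} (hε : ε ^ 2 < γ 1 * lam j) : (j : ℕ∞) ≤ infoN γ lam ε 1 := by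
  have hinj : Function.Injective fun (i : ℕ) (_ : Fin 1) => i := fun a b h => congrFun h 0
  have hsub : (fun (i : ℕ) (_ : Fin 1) => i) '' (Finset.Icc 1 j : Finset ℕ) ⊆
      {n : Fin 1 → ℕ | (∀ i, 1 ≤ n i) ∧ ε ^ 2 < ∏ i, lamKJ γ lam (i.1 + 1) (n i)} := by
    rintro _ ⟨i, hi, rfl⟩
    obtain ⟨hi1, hij⟩ := Finset.mem_Icc.1 (Finset.mem_coe.1 hi)
    refine ⟨fun _ => hi1, ?_⟩
    simp only [Finset.univ_unique, Finset.prod_singleton, Fin.default_eq_zero, Fin.val_zero,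
      zero_add]
    refine (hε.trans_le ?_).trans_le (le_lamKJ hlam1 hγ_le le_rfl i)
    exact mul_le_mul_of_nonneg_left
      (hlam_anti (mem_Ici.2 hi1) (mem_Ici.2 (hi1.trans hij)) hij) (hγ_pos 1 le_rfl).le
  have h := Set.encard_le_encard hsub
  rw [hinj.encard_image, Set.encard_coe_eq_coe_finsetCard, Nat.card_Icc,
    Nat.add_sub_cancel] at h
  exact h

theorem eventually_of_expSTWT {γ lam : ℕ → ℝ}
    (hlam_anti : AntitoneOn lam (Set.Ici 1)) (hlam1 : lam 1 = 1)
    (hlam_nonneg : ∀ j, 1 ≤ j → 0 ≤ lam j)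
    (hγ_pos : ∀ j, 1 ≤ j → 0 < γ j) (hγ_le : ∀ j, 1 ≤ j → γ j ≤ 1)
    {s t : ℝ} (hs : 1 < s) (h : ExpSTWT γ lam s t) {M : ℝ} (hM : 0 < M) :
    ∀ᶠ j : ℕ in atTop, lam j = 0 ∨ M * Real.log j < Real.log ((lam j)⁻¹) ^ s := by
  obtain ⟨T, hT⟩ := h (1 / (2 * M)) (by positivity)
  have hγ1 : 0 < γ 1 := hγ_pos 1 le_rfl
  obtain ⟨a, ha0, ha⟩ : ∃ a : ℝ, 0 < a ∧ a ≤ 1 ∧ a ≤ (max T 1)⁻¹ ∧ a ^ 2 < γ 1 := by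
    have hT0 : 0 < (max T 1)⁻¹ := by positivity
    refine ⟨min (min 1 (max T 1)⁻¹) (γ 1 / 2), by positivity,
      (min_le_left _ _).trans (min_le_left _ _), (min_le_left _ _).trans (min_le_right _ _), ?_⟩
    set b := min (min 1 (max T 1)⁻¹) (γ 1 / 2) with hb
    have hb0 : 0 < b := by positivity
    have hb1 : b ≤ 1 := (min_le_left _ _).trans (min_le_left _ _)
    have hb2 : b ≤ γ 1 / 2 := min_le_right _ _
    nlinarith
  obtain ⟨ha1, haT, haγ⟩ := ha
  set K : ℝ := 1 + Real.log a⁻¹ with hK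
  have hK1 : 1 ≤ K := by
    have := Real.log_nonneg ((one_le_inv₀ ha0).2 ha1)
    linarith
  have hlarge : ∀ᶠ j : ℕ in atTop, 1 / (2 * M) * (1 + (2 * K) ^ s) ≤ Real.log j :=
    (Real.tendsto_log_atTop.comp tendsto_natCast_atTop_atTop).eventually_ge_atTop _
  filter_upwards [hlarge, eventually_ge_atTop 1] with j hj hj1
  rcases (hlam_nonneg j hj1).eq_or_lt with h0 | hpos
  · exact Or.inl h0.symm
  right
  have hle1 : lam j ≤ 1 := le_one_of_antitoneOn hlam_anti hlam1 hj1
  set L := Real.log ((lam j)⁻¹) with hL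
  have hL0 : 0 ≤ L := Real.log_nonneg ((one_le_inv₀ hpos).2 hle1)
  have hsq0 : 0 < √(lam j) := Real.sqrt_pos.2 hpos
  have hsq1 : √(lam j) ≤ 1 := Real.sqrt_le_one.2 hle1
  set ε := a * √(lam j) with hε
  have hε0 : 0 < ε := by positivity
  have hεa : ε ≤ a := mul_le_of_le_one_right ha0.le hsq1
  have hTε : T ≤ ((1 : ℕ) : ℝ) + ε⁻¹ := by
    have h1 : max T 1 ≤ ε⁻¹ := by
      rw [le_inv_comm₀ (by positivity) hε0]
      exact hεa.trans haT
    have := le_max_left T 1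
    push_cast
    linarith
  obtain ⟨N, hN, hNlt⟩ := hT 1 le_rfl ε hε0 (hεa.trans ha1) hTε
  have hjN : (j : ℝ) ≤ N := by
    have hinfo : (j : ℕ∞) ≤ infoN γ lam ε 1 := by
      apply natCast_le_infoN_one hlam_anti hlam1 hγ_pos hγ_le
      rw [hε, mul_pow, Real.sq_sqrt hpos.le]
      gcongr
    rw [hN] at hinfo
    exact_mod_cast hinfo
  have hlogε : Real.log ε⁻¹ = Real.log a⁻¹ + L / 2 := by
    rw [hε, hL, Real.log_inv, Real.log_inv, Real.log_inv, Real.log_mul ha0.ne' hsq0.ne',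
      Real.log_sqrt hpos.le]
    ring
  have hj0 : (0 : ℝ) < j := by exact_mod_cast hj1
  have hlogj : Real.log j ≤ Real.log (max 1 (N : ℝ)) :=
    Real.log_le_log hj0 (hjN.trans (le_max_right _ _))
  have hden : (0 : ℝ) < ((1 : ℕ) : ℝ) ^ t + (1 + Real.log ε⁻¹) ^ s := by
    have : 0 ≤ 1 + Real.log ε⁻¹ := by rw [hlogε]; linarith
    push_cast
    rw [Real.one_rpow]
    positivity
  rw [div_lt_iff₀ hden, hlogε, ← add_assoc, ← hK, Nat.cast_one, Real.one_rpow] at hNlt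
  have hlt : Real.log j < 1 / (2 * M) * (1 + (K + L / 2) ^ s) := hlogj.trans_lt hNlt
  have hKL : K < L / 2 := by
    by_contra! hcon
    have : (K + L / 2) ^ s ≤ (2 * K) ^ s :=
      Real.rpow_le_rpow (by linarith) (by linarith) (by linarith)
    have : 1 / (2 * M) * (1 + (K + L / 2) ^ s) ≤ 1 / (2 * M) * (1 + (2 * K) ^ s) := by gcongr
    linarith
  have h1 : (K + L / 2) ^ s ≤ L ^ s :=
    Real.rpow_le_rpow (by linarith) (by linarith) (by linarith)
  have h2 : 1 ≤ L ^ s := Real.one_le_rpow (by linarith) (by linarith)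
  calc M * Real.log j < M * (1 / (2 * M) * (1 + (K + L / 2) ^ s)) := by gcongr
    _ = (1 + (K + L / 2) ^ s) / 2 := by field_simp
    _ ≤ L ^ s := by linarith

theorem exists_infoN_eq_log_le {γ lam : ℕ → ℝ}
    (hlam_anti : AntitoneOn lam (Set.Ici 1)) (hlam1 : lam 1 = 1)
    (hlam_nonneg : ∀ j, 1 ≤ j → 0 ≤ lam j)
    (hγ_pos : ∀ j, 1 ≤ j → 0 < γ j) (hγ_le : ∀ j, 1 ≤ j → γ j ≤ 1)
    {s : ℝ} (hs : 1 < s) {M : ℝ} (hM : 0 < M)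
    (h : ∀ᶠ j : ℕ in atTop, lam j = 0 ∨ M * Real.log j < Real.log ((lam j)⁻¹) ^ s) :
    ∃ C : ℝ, 0 ≤ C ∧ ∀ (d : ℕ) (ε : ℝ), 0 < ε → ε ≤ 1 → ∃ N : ℕ, infoN γ lam ε d = N ∧
      Real.log (max 1 (N : ℝ)) ≤ C * d + 2 / M * (2 * Real.log ε⁻¹) ^ s := by
  obtain ⟨J, hJ⟩ := eventually_atTop.1 h
  obtain ⟨Z, hZ1, hZ⟩ := exists_bound_sum_inv_sq
  have hb0 : 0 ≤ Real.log (max 1 (J : ℝ)) := Real.log_nonneg (le_max_left _ _)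
  set b := Real.log (max 1 (J : ℝ)) with hb
  have hZ0 : 0 ≤ Real.log Z := Real.log_nonneg hZ1
  have hl0 : ∀ j, 1 ≤ j → lam j ≠ 0 → 0 ≤ Real.log ((lam j)⁻¹) := fun j hj hne =>
    Real.log_nonneg ((one_le_inv₀ ((hlam_nonneg j hj).lt_of_ne' hne)).2
      (le_one_of_antitoneOn hlam_anti hlam1 hj))
  have hlog : ∀ j : ℕ, 1 ≤ j → lam j ≠ 0 →
      Real.log j ≤ b + Real.log ((lam j)⁻¹) ^ s / M := by
    intro j hj hne
    have hp : 0 ≤ Real.log ((lam j)⁻¹) ^ s := Real.rpow_nonneg (hl0 j hj hne) s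
    rcases le_total J j with hJj | hJj
    · have h1 := (hJ j hJj).resolve_left hne
      have h2 : Real.log j ≤ Real.log ((lam j)⁻¹) ^ s / M := by
        rw [le_div_iff₀ hM]
        linarith
      linarith
    · have h1 : Real.log j ≤ b := by
        refine Real.log_le_log (by exact_mod_cast hj) (le_max_of_le_right ?_)
        exact_mod_cast hJj
      have : 0 ≤ Real.log ((lam j)⁻¹) ^ s / M := by positivity
      linarith
  refine ⟨2 * b + Real.log Z, by positivity, fun d ε hε0 hε1 => ?_⟩
  have hE0 : 0 ≤ Real.log ε⁻¹ := Real.log_nonneg ((one_le_inv₀ hε0).2 hε1)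
  set L := 2 * Real.log ε⁻¹ with hL
  have hL0 : 0 ≤ L := by positivity
  obtain ⟨N, hN, hNle⟩ := exists_encard_eq_of_prod_le (d := d)
    (A := {n : Fin d → ℕ | (∀ i, 1 ≤ n i) ∧ ε ^ 2 < ∏ i, lamKJ γ lam (i.1 + 1) (n i)})
    (X := Real.exp (d * b + L ^ s / M)) hZ (by
      rintro n ⟨hn1, hn⟩
      refine ⟨hn1, ?_⟩
      have hn' : ε ^ 2 < ∏ i, lam (n i) := hn.trans_le <| Finset.prod_le_prod
        (fun i _ => lamKJ_nonneg hlam_nonneg hγ_pos (Nat.le_add_left 1 _) (hn1 i))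
        fun i _ => lamKJ_le hlam1 hlam_nonneg hγ_le (Nat.le_add_left 1 _) (hn1 i)
      have hε2 : 0 < ε ^ 2 := by positivity
      have hne : ∀ i, lam (n i) ≠ 0 := fun i =>
        Finset.prod_ne_zero_iff.1 (hε2.trans hn').ne' i (Finset.mem_univ i)
      have hsum : ∑ i, Real.log ((lam (n i))⁻¹) ≤ L := by
        have h1 := Real.log_le_log hε2 hn'.le
        rw [Real.log_prod fun i _ => hne i, Real.log_pow] at h1
        simp only [hL, Real.log_inv, Finset.sum_neg_distrib]
        push_cast at h1
        linarith
      have hpos : 0 < ∏ i, (n i : ℝ) :=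
        Finset.prod_pos fun i _ => by exact_mod_cast hn1 i
      rw [← Real.log_le_iff_le_exp hpos,
        Real.log_prod fun i _ => by exact_mod_cast (Nat.one_le_iff_ne_zero.1 (hn1 i))]
      calc ∑ i, Real.log (n i) ≤ ∑ i, (b + Real.log ((lam (n i))⁻¹) ^ s / M) :=
            Finset.sum_le_sum fun i _ => hlog _ (hn1 i) (hne i)
        _ = d * b + (∑ i, Real.log ((lam (n i))⁻¹) ^ s) / M := by
            rw [Finset.sum_add_distrib, Finset.sum_div]
            simp
        _ ≤ d * b + L ^ s / M := by
            gcongr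
            exact sum_rpow_le_rpow_of_sum_le hs (fun i _ => hl0 _ (hn1 i) (hne i)) hsum)
  refine ⟨N, hN, ?_⟩
  have hexp : Real.exp (d * b + L ^ s / M) ^ 2 * Z ^ d =
      Real.exp ((2 * b + Real.log Z) * d + 2 / M * L ^ s) := by
    have hZd : Z ^ d = Real.exp (d * Real.log Z) := by
      rw [Real.exp_nat_mul, Real.exp_log (by linarith)]
    rw [hZd, ← Real.exp_nat_mul, ← Real.exp_add]
    congr 1
    push_cast
    ring
  rw [hexp] at hNle
  rw [Real.log_le_iff_le_exp (by positivity)]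
  refine max_le (Real.one_le_exp ?_) hNle
  have : 0 ≤ L ^ s := Real.rpow_nonneg hL0 s
  positivity

theorem exists_mul_le_rpow_add {t C η : ℝ} (ht : 1 < t) (hC : 0 ≤ C) (hη : 0 < η) :
    ∃ B : ℝ, 0 ≤ B ∧ ∀ d : ℕ, 1 ≤ d → C * d ≤ η * (d : ℝ) ^ t + B := by
  have hev : ∀ᶠ d : ℕ in atTop, C / η ≤ (d : ℝ) ^ (t - 1) :=
    ((tendsto_rpow_atTop (by linarith : 0 < t - 1)).comp
      tendsto_natCast_atTop_atTop).eventually_ge_atTop _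
  obtain ⟨D, hD⟩ := eventually_atTop.1 hev
  refine ⟨C * D, by positivity, fun d hd => ?_⟩
  rcases le_total D d with h | h
  · have h1 := hD d h
    rw [div_le_iff₀ hη] at h1
    have h2 : (d : ℝ) ^ t = (d : ℝ) ^ (t - 1) * d := by
      rw [← Real.rpow_add_one' (by positivity) (by linarith), sub_add_cancel]
    have h3 : C * d ≤ (d : ℝ) ^ (t - 1) * η * d := by gcongr
    have h4 : 0 ≤ C * (D : ℝ) := by positivity
    rw [h2]
    linarith
  · have h1 : C * (d : ℝ) ≤ C * D := by gcongr
    have h2 : 0 ≤ η * (d : ℝ) ^ t := by positivity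
    linarith

theorem expSTWT_of_eventually {γ lam : ℕ → ℝ}
    (hlam_anti : AntitoneOn lam (Set.Ici 1)) (hlam1 : lam 1 = 1)
    (hlam_nonneg : ∀ j, 1 ≤ j → 0 ≤ lam j)
    (hγ_pos : ∀ j, 1 ≤ j → 0 < γ j) (hγ_le : ∀ j, 1 ≤ j → γ j ≤ 1)
    {s t : ℝ} (hs : 1 < s) (ht : 1 < t)
    (h : ∀ M : ℝ, 0 < M → ∀ᶠ j : ℕ in atTop,
      lam j = 0 ∨ M * Real.log j < Real.log ((lam j)⁻¹) ^ s) :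
    ExpSTWT γ lam s t := by
  intro δ hδ
  have hM : 0 < 4 * 2 ^ s / δ := by positivity
  obtain ⟨C, hC0, hC⟩ := exists_infoN_eq_log_le hlam_anti hlam1 hlam_nonneg hγ_pos hγ_le hs hM
    (h _ hM)
  obtain ⟨B, hB0, hB⟩ := exists_mul_le_rpow_add ht hC0 (by positivity : 0 < δ / 4)
  set R := 8 * B / δ with hR
  refine ⟨R + Real.exp R, fun d hd ε hε0 hε1 hT => ?_⟩
  obtain ⟨N, hN, hNle⟩ := hC d ε hε0 hε1
  refine ⟨N, hN, ?_⟩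
  have hE0 : 0 ≤ Real.log ε⁻¹ := Real.log_nonneg ((one_le_inv₀ hε0).2 hε1)
  have hd1 : (1 : ℝ) ≤ d := by exact_mod_cast hd
  have hdt : (d : ℝ) ≤ (d : ℝ) ^ t := Real.self_le_rpow_of_one_le hd1 ht.le
  have hEs : 1 + Real.log ε⁻¹ ≤ (1 + Real.log ε⁻¹) ^ s :=
    Real.self_le_rpow_of_one_le (by linarith) hs.le
  have hEs' : Real.log ε⁻¹ ^ s ≤ (1 + Real.log ε⁻¹) ^ s :=
    Real.rpow_le_rpow hE0 (by linarith) (by linarith)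
  have hRle : R < (d : ℝ) ^ t + (1 + Real.log ε⁻¹) ^ s := by
    rcases le_total R d with hRd | hRd
    · linarith
    · have h1 : Real.exp R ≤ ε⁻¹ := by linarith
      have h2 : R ≤ Real.log ε⁻¹ := (Real.le_log_iff_exp_le (by positivity)).2 h1
      linarith
  have hterm : 2 / (4 * 2 ^ s / δ) * (2 * Real.log ε⁻¹) ^ s = δ / 2 * Real.log ε⁻¹ ^ s := by
    rw [Real.mul_rpow zero_le_two hE0]
    have : (0 : ℝ) < 2 ^ s := by positivity
    field_simp
    ring
  rw [hterm] at hNle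
  rw [div_lt_iff₀ (by linarith)]
  have hBd := hB d hd
  have hBR : B = δ / 8 * R := by
    rw [hR]
    field_simp
  have h1 : δ / 8 * R < δ / 8 * ((d : ℝ) ^ t + (1 + Real.log ε⁻¹) ^ s) := by gcongr
  have h2 : δ / 2 * Real.log ε⁻¹ ^ s ≤ δ / 2 * (1 + Real.log ε⁻¹) ^ s := by gcongr
  have h3 : 0 < δ * (d : ℝ) ^ t := mul_pos hδ (by linarith)
  have h4 : 0 < δ * (1 + Real.log ε⁻¹) ^ s := mul_pos hδ (by linarith)
  linarith

/-- for s > 1 and t > 1, EXP-(s,t)-WT holds iff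
(log λ_j⁻¹)^s / log j → ∞ (understood to hold at j whenever λ_j = 0); no condition on
the weights γ_j is needed. -/
theorem stmt8 (γ lam : ℕ → ℝ)
    (hlam_anti : AntitoneOn lam (Set.Ici 1)) (hlam1 : lam 1 = 1) (hlam2 : 0 < lam 2)
    (hlam_nonneg : ∀ j, 1 ≤ j → 0 ≤ lam j)
    (hγ_anti : AntitoneOn γ (Set.Ici 1))
    (hγ_pos : ∀ j, 1 ≤ j → 0 < γ j) (hγ_le : ∀ j, 1 ≤ j → γ j ≤ 1)
    (s t : ℝ) (hs : 1 < s) (ht : 1 < t) :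
    ExpSTWT γ lam s t ↔
      (∀ M : ℝ, 0 < M → ∀ᶠ j : ℕ in atTop,
        lam j = 0 ∨ M * Real.log j < Real.log ((lam j)⁻¹) ^ s) := by
  exact ⟨fun h _ hM => eventually_of_expSTWT hlam_anti hlam1 hlam_nonneg hγ_pos hγ_le hs h hM,
    expSTWT_of_eventually hlam_anti hlam1 hlam_nonneg hγ_pos hγ_le hs ht⟩
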